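/- (MLP compression error.) Let C be a symmetric positive definite real d×d matrix with eigenvalues σ₁(C) ≥ … ≥ σ_d(C), let k < d, set λ = (1/k)Σ_{i=k+1}^d σ_i(C), and define the ridge leverage scores s_i = [C(C+λI)^{-1}]_{ii} for i = 1, …, d. Let S be the d×k column selection matrix selecting the k indices with the largest scores s_i, assume SᵀCS is invertible, and suppose ε ∈ (0,1) satisfies ε ≥ Σ over the d−k unselected indices of s_i. Let A_1, …, A_N be real T×d matrices with C = Σ_{i=1}^N A_iᵀA_i, let W_D be a real d×m matrix, and set Ŵ_D = (SᵀCS)^{-1}SᵀCW_D. Then Σ_{i=1}^N ‖A_i W_D − (A_i S)Ŵ_D‖_F² ≤ ‖W_D‖₂² · ‖C^{-1}‖₂ · (ε²d²)/(k²(1−ε)²) · Σ_{i=k+1}^d σ_i(C)². -/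

import Mathlib

open Matrix BigOperators

noncomputable section

/-- Squared Frobenius norm of a real matrix: `‖A‖_F² = ∑ᵢⱼ Aᵢⱼ²`. -/
def frobSq {m n : Type*} [Fintype m] [Fintype n] (A : Matrix m n ℝ) : ℝ :=
  ∑ i, ∑ j, (A i j) ^ 2

/-- Frobenius norm of a real matrix. -/
def frobNorm {m n : Type*} [Fintype m] [Fintype n] (A : Matrix m n ℝ) : ℝ :=
  Real.sqrt (frobSq A)

/-- Spectral norm (ℓ²→ℓ² operator norm, largest singular value) of a real matrix. -/
def specNorm {m n : Type*} [Fintype m] [Fintype n] [DecidableEq n] (A : Matrix m n ℝ) : ℝ :=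
  ‖LinearMap.toContinuousLinearMap (Matrix.toEuclideanLin A)‖

/-- `S` is a `k`-column selection matrix whose columns are the distinct standard basis
vectors indexed by the injective map `f`. -/
def IsColSel {d k : ℕ} (f : Fin k → Fin d) (S : Matrix (Fin d) (Fin k) ℝ) : Prop :=
  Function.Injective f ∧ ∀ i j, S i j = if i = f j then 1 else 0

lemma frobSq_eq_trace {m n : Type*} [Fintype m] [Fintype n] (A : Matrix m n ℝ) :
    frobSq A = (Aᵀ * A).trace := by
  simp only [frobSq, Matrix.trace, Matrix.diag_apply, Matrix.mul_apply, Matrix.transpose_apply]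
  rw [Finset.sum_comm]
  simp only [sq]

lemma specNorm_transpose {m n : Type*} [Fintype m] [Fintype n] [DecidableEq m] [DecidableEq n]
    (A : Matrix m n ℝ) : specNorm Aᵀ = specNorm A := by
  rw [← Matrix.conjTranspose_eq_transpose_of_trivial]
  exact Matrix.l2_opNorm_conjTranspose A

lemma sum_sq_mulVec_le {m n : Type*} [Fintype m] [Fintype n] [DecidableEq n]
    (A : Matrix m n ℝ) (x : n → ℝ) :
    ∑ i, (A *ᵥ x) i ^ 2 ≤ specNorm A ^ 2 * ∑ j, x j ^ 2 := by
  have h := (LinearMap.toContinuousLinearMap (Matrix.toEuclideanLin A)).le_opNorm (WithLp.toLp 2 x)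
  have h2 := pow_le_pow_left₀ (norm_nonneg _) h 2
  rw [mul_pow, EuclideanSpace.norm_sq_eq, EuclideanSpace.norm_sq_eq] at h2
  simpa [specNorm] using h2

lemma specNorm_nonneg {m n : Type*} [Fintype m] [Fintype n] [DecidableEq n] (A : Matrix m n ℝ) :
    0 ≤ specNorm A :=
  norm_nonneg _

lemma dotProduct_mulVec_le_specNorm {n : Type*} [Fintype n] [DecidableEq n]
    (A : Matrix n n ℝ) (x : n → ℝ) :
    x ⬝ᵥ (A *ᵥ x) ≤ specNorm A * ∑ j, x j ^ 2 := by
  have hx : 0 ≤ ∑ j, x j ^ 2 := Finset.sum_nonneg fun _ _ => sq_nonneg _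
  refine abs_le_of_sq_le_sq' ?_ (mul_nonneg (specNorm_nonneg A) hx) |>.2
  calc (x ⬝ᵥ (A *ᵥ x)) ^ 2 ≤ (∑ j, x j ^ 2) * ∑ j, (A *ᵥ x) j ^ 2 :=
        Finset.sum_mul_sq_le_sq_mul_sq _ _ _
    _ ≤ (∑ j, x j ^ 2) * (specNorm A ^ 2 * ∑ j, x j ^ 2) := by
        gcongr
        exact sum_sq_mulVec_le A x
    _ = (specNorm A * ∑ j, x j ^ 2) ^ 2 := by ring

lemma frobSq_mul_le {l m n : Type*} [Fintype l] [Fintype m] [Fintype n]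
    [DecidableEq m] [DecidableEq n] (B : Matrix l m ℝ) (W : Matrix m n ℝ) :
    frobSq (B * W) ≤ specNorm W ^ 2 * frobSq B := by
  unfold frobSq
  rw [Finset.mul_sum]
  refine Finset.sum_le_sum fun i _ => ?_
  have h := sum_sq_mulVec_le Wᵀ (B i)
  rw [specNorm_transpose] at h
  simpa [Matrix.mulVec_transpose, Matrix.vecMul, Matrix.mul_apply, dotProduct] using h

lemma Matrix.PosSemidef.frobSq_le_trace_sq {n : Type*} [Fintype n] {A : Matrix n n ℝ}
    (hA : A.PosSemidef) : frobSq A ≤ A.trace ^ 2 := by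
  have h (i j : n) : A i j ^ 2 ≤ A i i * A j j := by
    have hdet := (hA.submatrix ![i, j]).det_nonneg
    have hsymm : A j i = A i j := by simpa using hA.isHermitian.apply i j
    rw [Matrix.det_fin_two] at hdet
    simp [hsymm] at hdet
    nlinarith
  rw [sq, Matrix.trace, Finset.sum_mul_sum]
  exact Finset.sum_le_sum fun i _ => Finset.sum_le_sum fun j _ => h i j

lemma Matrix.PosSemidef.trace_mul_le {n : Type*} [Fintype n] {A B : Matrix n n ℝ}
    (hA : A.PosSemidef) (hB : B.PosSemidef) : (A * B).trace ≤ A.trace * B.trace := by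
  refine abs_le_of_sq_le_sq' ?_ (mul_nonneg hA.trace_nonneg hB.trace_nonneg) |>.2
  have h := Finset.sum_mul_sq_le_sq_mul_sq (Finset.univ : Finset (n × n))
    (fun p => A p.1 p.2) (fun p => B p.2 p.1)
  simp only [Fintype.sum_prod_type] at h
  calc (A * B).trace ^ 2 ≤ frobSq A * frobSq B := by
        rw [show frobSq B = ∑ i, ∑ j, B j i ^ 2 from Finset.sum_comm]
        simpa [Matrix.trace, Matrix.mul_apply, frobSq] using h
    _ ≤ A.trace ^ 2 * B.trace ^ 2 :=
        mul_le_mul hA.frobSq_le_trace_sq hB.frobSq_le_trace_sq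
          (Finset.sum_nonneg fun _ _ => Finset.sum_nonneg fun _ _ => sq_nonneg _) (sq_nonneg _)
    _ = (A.trace * B.trace) ^ 2 := by ring

lemma Matrix.PosDef.posSemidef_inv_sub_inv {n : Type*} [Fintype n] [DecidableEq n]
    {A B : Matrix n n ℝ} (hA : A.PosDef) (hB : B.PosDef) (hAB : (B - A).PosSemidef) :
    (A⁻¹ - B⁻¹).PosSemidef := by
  have hA1 : A * A⁻¹ = 1 := A.mul_nonsing_inv ((A.isUnit_iff_isUnit_det).1 hA.isUnit)
  have hB1 : B * B⁻¹ = 1 := B.mul_nonsing_inv ((B.isUnit_iff_isUnit_det).1 hB.isUnit)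
  have hA2 : A⁻¹ * A = 1 := A.nonsing_inv_mul ((A.isUnit_iff_isUnit_det).1 hA.isUnit)
  have hB2 : B⁻¹ * B = 1 := B.nonsing_inv_mul ((B.isUnit_iff_isUnit_det).1 hB.isUnit)
  have hBs : (B⁻¹)ᴴ = B⁻¹ := hB.inv.isHermitian
  have hDs : (B - A)ᴴ = B - A := hAB.isHermitian
  have key : A⁻¹ - B⁻¹ = (B⁻¹)ᴴ * (B - A) * B⁻¹
      + ((B - A) * B⁻¹)ᴴ * A⁻¹ * ((B - A) * B⁻¹) := by
    rw [Matrix.conjTranspose_mul, hBs, hDs]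
    have h1 : B⁻¹ * (B - A) * A⁻¹ = A⁻¹ - B⁻¹ := by
      rw [Matrix.mul_sub, hB2, Matrix.sub_mul, Matrix.mul_assoc, hA1, Matrix.one_mul,
        Matrix.mul_one]
    rw [h1]
    simp only [Matrix.mul_sub, Matrix.sub_mul, hB1, hB2, hA2, Matrix.mul_one, Matrix.one_mul,
      Matrix.mul_assoc, ← Matrix.mul_assoc A⁻¹ A]
    abel
  rw [key]
  exact (hAB.conjTranspose_mul_mul_same _).add (hA.inv.posSemidef.conjTranspose_mul_mul_same _)

lemma Matrix.PosSemidef.posDef_add_smul_one {n : Type*} [Fintype n] [DecidableEq n]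
    {L : Matrix n n ℝ} (hL : L.PosSemidef) {r : ℝ} (hr : 0 < r) :
    (L + r • (1 : Matrix n n ℝ)).PosDef :=
  Matrix.PosDef.posSemidef_add hL (Matrix.PosDef.one.smul hr)

lemma Matrix.PosSemidef.ridge_eq {n : Type*} [Fintype n] [DecidableEq n]
    {L : Matrix n n ℝ} (hL : L.PosSemidef) {r : ℝ} (hr : 0 < r) :
    L * (L + r • (1 : Matrix n n ℝ))⁻¹ = 1 - r • (L + r • (1 : Matrix n n ℝ))⁻¹ := by
  have hP := hL.posDef_add_smul_one hr
  have h := Matrix.mul_nonsing_inv _ ((Matrix.isUnit_iff_isUnit_det _).1 hP.isUnit)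
  rw [Matrix.add_mul, Matrix.smul_mul, Matrix.one_mul] at h
  exact eq_sub_of_add_eq h

lemma Matrix.PosSemidef.ridge_eq' {n : Type*} [Fintype n] [DecidableEq n]
    {L : Matrix n n ℝ} (hL : L.PosSemidef) {r : ℝ} (hr : 0 < r) :
    (L + r • (1 : Matrix n n ℝ))⁻¹ * L = 1 - r • (L + r • (1 : Matrix n n ℝ))⁻¹ := by
  have hP := hL.posDef_add_smul_one hr
  have h := Matrix.nonsing_inv_mul _ ((Matrix.isUnit_iff_isUnit_det _).1 hP.isUnit)
  rw [Matrix.mul_add, Matrix.mul_smul, Matrix.mul_one] at h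
  exact eq_sub_of_add_eq h

lemma Matrix.PosSemidef.ridge_posSemidef {n : Type*} [Fintype n] [DecidableEq n]
    {L : Matrix n n ℝ} (hL : L.PosSemidef) {r : ℝ} (hr : 0 < r) :
    (L * (L + r • (1 : Matrix n n ℝ))⁻¹).PosSemidef := by
  have hP := hL.posDef_add_smul_one hr
  have hPs : ((L + r • (1 : Matrix n n ℝ))⁻¹)ᴴ = (L + r • (1 : Matrix n n ℝ))⁻¹ :=
    hP.inv.isHermitian
  have h1 := Matrix.nonsing_inv_mul _ ((Matrix.isUnit_iff_isUnit_det _).1 hP.isUnit)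
  have key : L * (L + r • (1 : Matrix n n ℝ))⁻¹ =
      ((L + r • (1 : Matrix n n ℝ))⁻¹)ᴴ * (Lᴴ * L + r • L) * (L + r • (1 : Matrix n n ℝ))⁻¹ := by
    rw [hPs, show Lᴴ * L + r • L = (L + r • (1 : Matrix n n ℝ)) * L by
      rw [hL.isHermitian.eq, Matrix.add_mul, Matrix.smul_mul, Matrix.one_mul],
      ← Matrix.mul_assoc _ _ L, h1, Matrix.one_mul]
  rw [key]
  exact ((Matrix.posSemidef_conjTranspose_mul_self L).add
    (hL.smul hr.le)).conjTranspose_mul_mul_same _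

lemma Matrix.PosSemidef.trace_le_of_trace_ridge_le {n : Type*} [Fintype n] [DecidableEq n]
    {L : Matrix n n ℝ} (hL : L.PosSemidef) {r ε : ℝ} (hr : 0 < r) (hε : ε < 1)
    (h : (L * (L + r • (1 : Matrix n n ℝ))⁻¹).trace ≤ ε) :
    L.trace ≤ r * ε / (1 - ε) := by
  have hN := hL.ridge_posSemidef hr
  have hLN := hL.trace_mul_le hN
  have hfix : L = r • (L * (L + r • (1 : Matrix n n ℝ))⁻¹)
      + L * (L * (L + r • (1 : Matrix n n ℝ))⁻¹) := by
    have h2 : L * (L * (L + r • (1 : Matrix n n ℝ))⁻¹) =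
        L - r • (L * (L + r • (1 : Matrix n n ℝ))⁻¹) := by
      conv_lhs => rw [hL.ridge_eq hr, Matrix.mul_sub, Matrix.mul_smul, Matrix.mul_one]
    rw [h2]
    abel
  have htr := congrArg Matrix.trace hfix
  rw [Matrix.trace_add, Matrix.trace_smul, smul_eq_mul] at htr
  rw [le_div_iff₀ (by linarith)]
  have hL0 := hL.trace_nonneg
  nlinarith [mul_le_mul_of_nonneg_left h hL0, mul_le_mul_of_nonneg_left h hr.le]

/-- Ridge leverage scores are monotone in the Loewner order. -/
lemma Matrix.PosSemidef.ridge_diag_le {n : Type*} [Fintype n] [DecidableEq n]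
    {L C : Matrix n n ℝ} (hL : L.PosSemidef) (hC : C.PosSemidef) (hLC : (C - L).PosSemidef)
    {r : ℝ} (hr : 0 < r) (i : n) :
    (L * (L + r • (1 : Matrix n n ℝ))⁻¹) i i ≤ (C * (C + r • (1 : Matrix n n ℝ))⁻¹) i i := by
  have h := ((hL.posDef_add_smul_one hr).posSemidef_inv_sub_inv (hC.posDef_add_smul_one hr)
    (by simpa using hLC)).diag_nonneg (i := i)
  rw [hL.ridge_eq hr, hC.ridge_eq hr]
  simp only [Matrix.sub_apply, Matrix.smul_apply, smul_eq_mul] at h ⊢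
  nlinarith

/-- The residual of the Nyström approximation of `C` from the columns selected by `S`. -/
def nystromResidual {n p : Type*} [Fintype n] [Fintype p] [DecidableEq p]
    (C : Matrix n n ℝ) (S : Matrix n p ℝ) : Matrix n n ℝ :=
  C - C * S * (Sᵀ * C * S)⁻¹ * Sᵀ * C

section Nystrom

variable {n p : Type*} [Fintype n] [Fintype p] [DecidableEq p]
  {C : Matrix n n ℝ} {S : Matrix n p ℝ}

lemma nystromResidual_mul_right (hinv : IsUnit (Sᵀ * C * S)) : nystromResidual C S * S = 0 := by
  have h := Matrix.nonsing_inv_mul _ ((Matrix.isUnit_iff_isUnit_det _).1 hinv)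
  have h2 : C * S * (Sᵀ * C * S)⁻¹ * Sᵀ * C * S = C * S * ((Sᵀ * C * S)⁻¹ * (Sᵀ * C * S)) := by
    simp only [Matrix.mul_assoc]
  rw [nystromResidual, Matrix.sub_mul, h2, h, Matrix.mul_one, sub_self]

lemma nystromResidual_transpose (hC : Cᵀ = C) :
    (nystromResidual C S)ᵀ = nystromResidual C S := by
  simp only [nystromResidual, Matrix.transpose_sub, Matrix.transpose_mul,
    Matrix.transpose_nonsing_inv, Matrix.transpose_transpose, hC, Matrix.mul_assoc]

lemma sub_nystromResidual_posSemidef (hC : C.PosSemidef) :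
    (C - nystromResidual C S).PosSemidef := by
  have hCs : Cᵀ = C := by simpa using hC.isHermitian.eq
  have hG := ((hC.conjTranspose_mul_mul_same S).inv).conjTranspose_mul_mul_same (Sᵀ * C)
  simpa [nystromResidual, hCs, Matrix.mul_assoc] using hG

variable [DecidableEq n]

lemma nystromResidual_eq_mul :
    nystromResidual C S = C * (1 - S * (Sᵀ * C * S)⁻¹ * Sᵀ * C) := by
  simp only [nystromResidual, Matrix.mul_sub, Matrix.mul_one, Matrix.mul_assoc]

lemma nystromResidual_mul_projection (hinv : IsUnit (Sᵀ * C * S)) :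
    nystromResidual C S * (1 - S * (Sᵀ * C * S)⁻¹ * Sᵀ * C) = nystromResidual C S := by
  rw [Matrix.mul_sub, Matrix.mul_one]
  simp only [← Matrix.mul_assoc]
  rw [nystromResidual_mul_right hinv]
  simp

lemma nystromResidual_eq_conj (hC : Cᵀ = C) (hinv : IsUnit (Sᵀ * C * S)) :
    nystromResidual C S = (1 - S * (Sᵀ * C * S)⁻¹ * Sᵀ * C)ᵀ * C *
      (1 - S * (Sᵀ * C * S)⁻¹ * Sᵀ * C) := by
  rw [Matrix.mul_assoc, ← nystromResidual_eq_mul]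
  have h := congrArg Matrix.transpose (nystromResidual_mul_projection hinv)
  rw [Matrix.transpose_mul, nystromResidual_transpose hC] at h
  exact h.symm

lemma nystromResidual_posSemidef (hC : C.PosSemidef) (hinv : IsUnit (Sᵀ * C * S)) :
    (nystromResidual C S).PosSemidef := by
  rw [nystromResidual_eq_conj (by simpa using hC.isHermitian.eq) hinv,
    ← Matrix.conjTranspose_eq_transpose_of_trivial]
  exact hC.conjTranspose_mul_mul_same _

lemma trace_nystromResidual_le_specNorm_mul (hC : C.PosDef) (hinv : IsUnit (Sᵀ * C * S)) :
    (nystromResidual C S).trace ≤ specNorm C⁻¹ * (nystromResidual C S).trace ^ 2 := by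
  set L := nystromResidual C S with hLdef
  have hCs : Cᵀ = C := by simpa using hC.isHermitian.eq
  have hLs : Lᵀ = L := nystromResidual_transpose hCs
  have hC1 := Matrix.nonsing_inv_mul _ ((Matrix.isUnit_iff_isUnit_det _).1 hC.isUnit)
  have hfix : Lᵀ * (C⁻¹ * L) = L := by
    rw [hLs, hLdef]
    nth_rewrite 2 [nystromResidual_eq_mul]
    rw [← Matrix.mul_assoc C⁻¹, hC1, Matrix.one_mul, nystromResidual_mul_projection hinv]
  have hdiag (i : n) : L i i ≤ specNorm C⁻¹ * ∑ j, L j i ^ 2 := by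
    have h := dotProduct_mulVec_le_specNorm C⁻¹ (fun j => L j i)
    have h2 : L i i = (fun j => L j i) ⬝ᵥ (C⁻¹ *ᵥ fun j => L j i) := by
      conv_lhs => rw [← hfix]
      rfl
    exact h2.trans_le h
  calc L.trace ≤ ∑ i, specNorm C⁻¹ * ∑ j, L j i ^ 2 := Finset.sum_le_sum fun i _ => hdiag i
    _ = specNorm C⁻¹ * frobSq L := by
        rw [← Finset.mul_sum, Finset.sum_comm, frobSq]
    _ ≤ specNorm C⁻¹ * L.trace ^ 2 :=
        mul_le_mul_of_nonneg_left
          (nystromResidual_posSemidef hC.posSemidef hinv).frobSq_le_trace_sq (specNorm_nonneg _)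

lemma trace_nystromResidual_le (hC : C.PosSemidef) (hinv : IsUnit (Sᵀ * C * S))
    (f : p → n) (hS : ∀ i j, S i j = if i = f j then 1 else 0) {r ε : ℝ} (hr : 0 < r) (hε : ε < 1)
    (h : ∑ i ∈ Finset.univ \ Finset.image f Finset.univ,
      (C * (C + r • (1 : Matrix n n ℝ))⁻¹) i i ≤ ε) :
    (nystromResidual C S).trace ≤ r * ε / (1 - ε) := by
  have hL := nystromResidual_posSemidef hC hinv
  refine hL.trace_le_of_trace_ridge_le hr hε (le_trans ?_ h)
  have hsel (j : p) (i : n) : nystromResidual C S i (f j) = 0 := by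
    have h0 := congrFun (congrFun (nystromResidual_mul_right hinv) i) j
    simpa [Matrix.mul_apply, hS] using h0
  rw [Matrix.trace, ← Finset.sum_subset (Finset.subset_univ
    (Finset.univ \ Finset.image f Finset.univ))]
  · exact Finset.sum_le_sum fun i _ =>
      hL.ridge_diag_le hC (sub_nystromResidual_posSemidef hC) hr i
  · intro i _ hi
    obtain ⟨j, rfl⟩ : ∃ j, f j = i := by simpa using hi
    rw [Matrix.diag_apply, hL.ridge_eq hr, ← hL.ridge_eq' hr, Matrix.mul_apply]
    simp [hsel]

end Nystrom

/-- **MLP compression error** (Proposition 1): guarantee of Type-I compression by Nyström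
approximation with deterministic ridge leverage score selection. Here `σ` lists the
eigenvalues of `C` in decreasing order. -/
theorem mlp_compression_error
    {T d k m N : ℕ} (hk : k < d)
    (C : Matrix (Fin d) (Fin d) ℝ) (hCpd : C.PosDef)
    (σ : Fin d → ℝ) (hσ_anti : Antitone σ)
    (hσ_eig : ∃ e : Fin d ≃ Fin d, ∀ i, σ i = hCpd.1.eigenvalues (e i))
    (lam : ℝ)
    (hlam : lam = (1 / (k : ℝ)) * ∑ i ∈ Finset.univ.filter (fun i : Fin d => k ≤ (i : ℕ)), σ i)
    (s : Fin d → ℝ)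
    (hs : ∀ i, s i = (C * (C + lam • (1 : Matrix (Fin d) (Fin d) ℝ))⁻¹) i i)
    (f : Fin k → Fin d) (S : Matrix (Fin d) (Fin k) ℝ) (hS : IsColSel f S)
    (htop : ∀ i ∈ Finset.univ \ Finset.image f Finset.univ, ∀ j : Fin k, s i ≤ s (f j))
    (hinv : IsUnit (Sᵀ * C * S))
    (ε : ℝ) (hε0 : 0 < ε) (hε1 : ε < 1)
    (hεs : ∑ i ∈ Finset.univ \ Finset.image f Finset.univ, s i ≤ ε)
    (A : Fin N → Matrix (Fin T) (Fin d) ℝ) (hC : C = ∑ i, (A i)ᵀ * A i)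
    (WD : Matrix (Fin d) (Fin m) ℝ)
    (WDhat : Matrix (Fin k) (Fin m) ℝ)
    (hWDhat : WDhat = (Sᵀ * C * S)⁻¹ * (Sᵀ * C * WD)) :
    ∑ i, frobSq (A i * WD - (A i * S) * WDhat) ≤
      specNorm WD ^ 2 * specNorm C⁻¹ *
        ((ε ^ 2 * (d : ℝ) ^ 2) / ((k : ℝ) ^ 2 * (1 - ε) ^ 2)) *
        ∑ i ∈ Finset.univ.filter (fun i : Fin d => k ≤ (i : ℕ)), σ i ^ 2 := by
  have hd : 0 < d := by omega
  rcases Nat.eq_zero_or_pos k with rfl | hk0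
  · exfalso
    have hlam0 : lam = 0 := by simp [hlam]
    have hs1 (i : Fin d) : s i = 1 := by
      rw [hs, hlam0, zero_smul, add_zero,
        Matrix.mul_nonsing_inv _ ((Matrix.isUnit_iff_isUnit_det _).1 hCpd.isUnit),
        Matrix.one_apply_eq]
    have hsum : (d : ℝ) ≤ ε := by simpa [hs1] using hεs
    have : (1 : ℝ) ≤ d := by exact_mod_cast hd
    linarith
  have hCs : Cᵀ = C := by simpa using hCpd.isHermitian.eq
  have hσ_pos (i : Fin d) : 0 < σ i := by
    obtain ⟨e, he⟩ := hσ_eig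
    rw [he]
    exact hCpd.eigenvalues_pos _
  set F := Finset.univ.filter (fun i : Fin d => k ≤ (i : ℕ)) with hF
  have hlam_pos : 0 < lam := by
    rw [hlam]
    exact mul_pos (by positivity)
      (Finset.sum_pos (fun i _ => hσ_pos i) ⟨⟨k, hk⟩, by simp [hF]⟩)
  have hlam_sq : lam ^ 2 ≤ (d : ℝ) ^ 2 / (k : ℝ) ^ 2 * ∑ i ∈ F, σ i ^ 2 := by
    have hcard : (F.card : ℝ) ≤ (d : ℝ) ^ 2 := by
      have h1 : F.card ≤ d := by simpa using Finset.card_le_univ F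
      exact_mod_cast h1.trans (Nat.le_self_pow two_ne_zero d)
    calc lam ^ 2 = (∑ i ∈ F, σ i) ^ 2 / (k : ℝ) ^ 2 := by rw [hlam]; ring
      _ ≤ ((d : ℝ) ^ 2 * ∑ i ∈ F, σ i ^ 2) / (k : ℝ) ^ 2 := by
          gcongr
          exact sq_sum_le_card_mul_sum_sq.trans
            (mul_le_mul_of_nonneg_right hcard (Finset.sum_nonneg fun _ _ => sq_nonneg _))
      _ = _ := by ring
  have htrace : (nystromResidual C S).trace ≤ lam * ε / (1 - ε) :=
    trace_nystromResidual_le hCpd.posSemidef hinv f hS.2 hlam_pos hε1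
      (by simpa only [← hs] using hεs)
  have htrace0 := (nystromResidual_posSemidef hCpd.posSemidef hinv).trace_nonneg
  set Q := 1 - S * (Sᵀ * C * S)⁻¹ * Sᵀ * C with hQ
  have hres (i : Fin N) : A i * WD - A i * S * WDhat = A i * Q * WD := by
    simp only [hWDhat, hQ, Matrix.mul_sub, Matrix.sub_mul, Matrix.mul_one, Matrix.mul_assoc]
  have hsum : ∑ i, frobSq (A i * Q) = (nystromResidual C S).trace := by
    have hconj : nystromResidual C S = Qᵀ * C * Q := nystromResidual_eq_conj hCs hinv
    rw [hconj]
    nth_rewrite 1 [hC]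
    simp only [Matrix.mul_sum, Matrix.sum_mul, Matrix.trace_sum, frobSq_eq_trace,
      Matrix.transpose_mul, Matrix.mul_assoc]
  have h1ε : 0 < 1 - ε := by linarith
  calc ∑ i, frobSq (A i * WD - A i * S * WDhat)
      ≤ ∑ i, specNorm WD ^ 2 * frobSq (A i * Q) := by
        simp only [hres]
        exact Finset.sum_le_sum fun i _ => frobSq_mul_le _ _
    _ = specNorm WD ^ 2 * (nystromResidual C S).trace := by rw [← Finset.mul_sum, hsum]
    _ ≤ specNorm WD ^ 2 * (specNorm C⁻¹ * (nystromResidual C S).trace ^ 2) := by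
        gcongr
        exact trace_nystromResidual_le_specNorm_mul hCpd hinv
    _ ≤ specNorm WD ^ 2 * (specNorm C⁻¹ * (lam * ε / (1 - ε)) ^ 2) := by
        have := specNorm_nonneg C⁻¹
        gcongr
    _ = specNorm WD ^ 2 * specNorm C⁻¹ * (ε ^ 2 / (1 - ε) ^ 2) * lam ^ 2 := by
        rw [div_pow]; ring
    _ ≤ specNorm WD ^ 2 * specNorm C⁻¹ * (ε ^ 2 / (1 - ε) ^ 2) *
        ((d : ℝ) ^ 2 / (k : ℝ) ^ 2 * ∑ i ∈ F, σ i ^ 2) := by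
        have := specNorm_nonneg C⁻¹
        gcongr
    _ = _ := by field_simp

end
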